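/- arXiv:2202.07932 — 2 statements merged into one kernel-verified Lean document; each statement's English description precedes it below -/
import Mathlib

section
/- Let n ∈ ℕ, a : Fin n → ℕ with a i ≥ 1 for all i, and T ∈ ℕ with T ≤ A, where A := ∑_i a i. Consider n + 1 jobs: for j ∈ Fin n, job j has processing time a j, weight a j and release date 0; the extra job N has processing time 1, weight 2 and release date T. Let y := ∑_{(i,j) : i ≤ j} a i · a j + A + T + 2 (pair sum over ordered pairs (i, j) ∈ Fin n × Fin n with i ≤ j). Then there exists S ⊆ Fin n with ∑_{i ∈ S} a i = T if and only if there exists a single-machine schedule s for these n + 1 jobs with s j ≥ r j for every job j and total weighted completion time ∑_j w j · (s j + p j) ≤ y. -/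
/-- A single-machine schedule: start times with pairwise disjoint execution intervals. -/
def IsSchedule {N : ℕ} (p : Fin N → ℕ) (s : Fin N → ℕ) : Prop :=
  ∀ i j : Fin N, i ≠ j → s i + p i ≤ s j ∨ s j + p j ≤ s i

/-- The sum of products over unordered pairs does not depend on the strict tournament used to
orient the pairs. -/
theorem two_mul_sum_tournament {ι : Type*} [Fintype ι] (a : ι → ℕ)
    (R : ι → ι → Prop) [DecidableRel R] (hR : ∀ i j, i ≠ j → (R i j ↔ ¬ R j i))
    (hirr : ∀ i, ¬ R i i) :
    2 * (∑ i, a i * ∑ k, if R k i then a k else 0) + ∑ i, a i * a i =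
      (∑ i, a i) * ∑ i, a i := by
  classical
  have hdiag : ∑ i, a i * a i = ∑ i, ∑ k, if i = k then a i * a k else 0 := by simp
  have hswap : (∑ i, a i * ∑ k, if R k i then a k else 0) =
      ∑ i, ∑ k, if R i k then a i * a k else 0 := by
    rw [Finset.sum_comm]
    refine Finset.sum_congr rfl fun i _ => ?_
    rw [Finset.mul_sum]
    refine Finset.sum_congr rfl fun k _ => ?_
    split_ifs <;> ring
  have hfwd : (∑ i, a i * ∑ k, if R k i then a k else 0) =
      ∑ i, ∑ k, if R k i then a i * a k else 0 := by
    simp only [Finset.mul_sum, mul_ite, mul_zero]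
  rw [two_mul]
  nth_rewrite 1 [hfwd]
  rw [hswap, hdiag, Finset.sum_mul_sum]
  simp only [← Finset.sum_add_distrib]
  refine Finset.sum_congr rfl fun i _ => Finset.sum_congr rfl fun k _ => ?_
  by_cases hik : i = k
  · subst hik
    simp [hirr]
  · by_cases h : R i k
    · simp [h, (hR i k hik).1 h, hik]
    · have h' : R k i := (hR k i (Ne.symm hik)).2 h
      simp [h, h', hik]

/-- Any strict tournament computes the sum of `a i * a j` over the pairs `i ≤ j`. -/
theorem sum_filter_le_eq_sum_tournament {n : ℕ} (a : Fin n → ℕ)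
    (R : Fin n → Fin n → Prop) [DecidableRel R] (hR : ∀ i j, i ≠ j → (R i j ↔ ¬ R j i))
    (hirr : ∀ i, ¬ R i i) :
    (∑ q ∈ Finset.univ.filter (fun q : Fin n × Fin n => q.1 ≤ q.2), a q.1 * a q.2) =
      (∑ i, a i * ∑ k, if R k i then a k else 0) + ∑ i, a i * a i := by
  have h₁ := two_mul_sum_tournament a R hR hirr
  have h₂ := two_mul_sum_tournament a (· < ·) (fun i j hij => by grind) (fun i => lt_irrefl i)
  have h₃ : (∑ q ∈ Finset.univ.filter (fun q : Fin n × Fin n => q.1 ≤ q.2), a q.1 * a q.2) =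
      (∑ i, a i * ∑ k, if k < i then a k else 0) + ∑ i, a i * a i := by
    have hdiag : ∑ i, a i * a i = ∑ i, ∑ k, if i = k then a i * a k else 0 := by simp
    rw [hdiag, Finset.sum_filter, Fintype.sum_prod_type_right, ← Finset.sum_add_distrib]
    refine Finset.sum_congr rfl fun i _ => ?_
    rw [Finset.mul_sum, ← Finset.sum_add_distrib]
    refine Finset.sum_congr rfl fun k _ => ?_
    rcases lt_trichotomy k i with h | h | h
    · simp [h, h.le, h.ne', mul_comm]
    · simp [h]
    · simp [h.not_ge, h.not_gt, h.ne]
  omega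

/-- The jobs completed by time `t` have total processing time at most `t`. -/
theorem IsSchedule.sum_completed_le {N : ℕ} {p s : Fin N → ℕ} (h : IsSchedule p s) (t : ℕ) :
    (∑ i, if s i + p i ≤ t then p i else 0) ≤ t := by
  rw [← Finset.sum_filter]
  calc ∑ i ∈ Finset.univ.filter (fun i => s i + p i ≤ t), p i
      = ∑ i ∈ Finset.univ.filter (fun i => s i + p i ≤ t),
          (Finset.Ico (s i) (s i + p i)).card := by simp
    _ = ((Finset.univ.filter (fun i => s i + p i ≤ t)).biUnion
          fun i => Finset.Ico (s i) (s i + p i)).card := by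
        refine (Finset.card_biUnion fun i _ j _ hij => ?_).symm
        rw [Function.onFun, Finset.disjoint_left]
        intro x hx hy
        rw [Finset.mem_Ico] at hx hy
        rcases h i j hij with h | h <;> omega
    _ ≤ (Finset.range t).card := by
        refine Finset.card_le_card fun x hx => ?_
        simp only [Finset.mem_biUnion, Finset.mem_filter, Finset.mem_univ, true_and,
          Finset.mem_Ico] at hx
        obtain ⟨i, hi, hx⟩ := hx
        rw [Finset.mem_range]
        omega
    _ = t := Finset.card_range t

/-- From a subset with sum `T`, a schedule that runs the subset first, then the barrier job at
time `T`, then the remaining jobs. -/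
theorem exists_schedule_of_sum_eq {n : ℕ} (a : Fin n → ℕ) (S : Finset (Fin n)) {T : ℕ}
    (hS : ∑ i ∈ S, a i = T) :
    ∃ s : Fin (n + 1) → ℕ, IsSchedule (Fin.snoc a 1) s ∧
      (∀ j, (Fin.snoc (fun _ => 0) T : Fin (n + 1) → ℕ) j ≤ s j) ∧
      ∑ j, (Fin.snoc a 2 : Fin (n + 1) → ℕ) j *
          (s j + (Fin.snoc a 1 : Fin (n + 1) → ℕ) j) =
        (∑ q ∈ Finset.univ.filter (fun q : Fin n × Fin n => q.1 ≤ q.2), a q.1 * a q.2) +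
          (∑ i, a i) + T + 2 := by
  let R : Fin n → Fin n → Prop := fun k i => (k ∈ S ∧ i ∉ S) ∨ ((k ∈ S ↔ i ∈ S) ∧ k < i)
  have hdec : DecidableRel R := fun k i => by unfold R; infer_instance
  have hR : ∀ i j, i ≠ j → (R i j ↔ ¬ R j i) := by
    intro i j hij
    simp only [R]
    grind
  have hirr : ∀ i, ¬ R i i := by
    intro i
    simp [R]
  have htrans : ∀ i j k, R i j → R j k → R i k := by
    intro i j k
    simp only [R]
    grind
  let u : Fin n → ℕ := fun i => (∑ k, if R k i then a k else 0) + if i ∈ S then 0 else 1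
  have hu : ∀ k i, R k i → u k + a k ≤ u i := by
    intro k i hki
    have hsum : (∑ l, if R l k then a l else 0) + a k ≤ ∑ l, if R l i then a l else 0 := by
      have : a k = ∑ l, if l = k then a l else 0 := by simp
      rw [this, ← Finset.sum_add_distrib]
      refine Finset.sum_le_sum fun l _ => ?_
      by_cases hlk : l = k
      · subst hlk
        simp [hirr, hki]
      · by_cases h : R l k
        · simp [h, hlk, htrans l k i h hki]
        · simp [h, hlk]
    have hite : (if k ∈ S then 0 else 1) ≤ if i ∈ S then 0 else 1 := by
      simp only [R] at hki
      split_ifs <;> grind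
    simp only [u]
    omega
  have hT : T = ∑ l, if l ∈ S then a l else 0 := by simp [← hS]
  have hbefore : ∀ i ∈ S, u i + a i ≤ T := by
    intro i hi
    have : a i = ∑ l, if l = i then a l else 0 := by simp
    simp only [u, hi, if_true, add_zero]
    rw [this, hT, ← Finset.sum_add_distrib]
    refine Finset.sum_le_sum fun l _ => ?_
    by_cases hli : l = i
    · subst hli
      simp [hirr, hi]
    · by_cases h : R l i
      · have hl : l ∈ S := by
          simp only [R] at h
          grind
        simp [h, hli, hl]
      · simp [h, hli]
  have hafter : ∀ i ∉ S, T + 1 ≤ u i := by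
    intro i hi
    simp only [u, hi, if_false]
    rw [hT]
    refine Nat.add_le_add_right (Finset.sum_le_sum fun l _ => ?_) 1
    by_cases hl : l ∈ S
    · have h : R l i := Or.inl ⟨hl, hi⟩
      simp [h, hl]
    · simp [hl]
  refine ⟨Fin.snoc u T, ?_, ?_, ?_⟩
  · intro i j hij
    induction i using Fin.lastCases with
    | last =>
      induction j using Fin.lastCases with
      | last => exact absurd rfl hij
      | cast j =>
        simp only [Fin.snoc_last, Fin.snoc_castSucc]
        by_cases hj : j ∈ S
        · exact Or.inr (hbefore j hj)
        · exact Or.inl (hafter j hj)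
    | cast i =>
      induction j using Fin.lastCases with
      | last =>
        simp only [Fin.snoc_last, Fin.snoc_castSucc]
        by_cases hi : i ∈ S
        · exact Or.inl (hbefore i hi)
        · exact Or.inr (hafter i hi)
      | cast j =>
        simp only [Fin.snoc_castSucc]
        have hij' : i ≠ j := fun h => hij (congrArg _ h)
        by_cases h : R i j
        · exact Or.inl (hu i j h)
        · exact Or.inr (hu j i ((hR j i hij'.symm).2 h))
  · intro j
    induction j using Fin.lastCases <;> simp
  · rw [Fin.sum_univ_castSucc, sum_filter_le_eq_sum_tournament a R hR hirr]
    simp only [Fin.snoc_last, Fin.snoc_castSucc]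
    have hsplit : ∑ i, a i * (u i + a i) =
        (∑ i, a i * ∑ k, if R k i then a k else 0) + (∑ i, a i * a i) +
          ∑ i, if i ∈ S then 0 else a i := by
      rw [← Finset.sum_add_distrib, ← Finset.sum_add_distrib]
      refine Finset.sum_congr rfl fun i _ => ?_
      simp only [u]
      split_ifs <;> ring
    have hA : ∑ i, a i = T + ∑ i, if i ∈ S then 0 else a i := by
      rw [hT, ← Finset.sum_add_distrib]
      refine Finset.sum_congr rfl fun i _ => ?_
      split_ifs <;> simp
    omega

/-- In a schedule of cost at most the threshold, the jobs completed before the barrier job have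
total processing time exactly `T`. -/
theorem exists_sum_eq_of_schedule {n : ℕ} (a : Fin n → ℕ) (ha : ∀ i, 1 ≤ a i) {T : ℕ}
    {s : Fin (n + 1) → ℕ} (hs : IsSchedule (Fin.snoc a 1) s) (hr : T ≤ s (Fin.last n))
    (hcost : ∑ j, (Fin.snoc a 2 : Fin (n + 1) → ℕ) j *
          (s j + (Fin.snoc a 1 : Fin (n + 1) → ℕ) j) ≤
        (∑ q ∈ Finset.univ.filter (fun q : Fin n × Fin n => q.1 ≤ q.2), a q.1 * a q.2) +
          (∑ i, a i) + T + 2) :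
    ∃ S : Finset (Fin n), ∑ i ∈ S, a i = T := by
  let R : Fin n → Fin n → Prop := fun k i => s k.castSucc + a k ≤ s i.castSucc
  have hdec : DecidableRel R := fun k i => by unfold R; infer_instance
  have hirr : ∀ i, ¬ R i i := by
    intro i
    have := ha i
    simp only [R]
    omega
  have hR : ∀ i j, i ≠ j → (R i j ↔ ¬ R j i) := by
    intro i j hij
    have h := hs i.castSucc j.castSucc (fun h => hij (Fin.castSucc_injective n h))
    simp only [Fin.snoc_castSucc] at h
    have := ha i
    have := ha j
    simp only [R]
    omega
  have hbarrier := hs.sum_completed_le (s (Fin.last n))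
  simp only [Fin.sum_univ_castSucc, Fin.snoc_castSucc, Fin.snoc_last] at hbarrier
  have hstart : ∀ i : Fin n, (∑ k, if R k i then a k else 0) +
      (if s i.castSucc + a i ≤ s (Fin.last n) then 0 else 1) ≤ s i.castSucc := by
    intro i
    have h := hs.sum_completed_le (s i.castSucc)
    simp only [Fin.sum_univ_castSucc, Fin.snoc_castSucc, Fin.snoc_last] at h
    refine le_trans (Nat.add_le_add_left ?_ _) h
    have h' := hs i.castSucc (Fin.last n) (Fin.castSucc_lt_last i).ne
    simp only [Fin.snoc_castSucc, Fin.snoc_last] at h'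
    split_ifs <;> omega
  rw [Fin.sum_univ_castSucc, sum_filter_le_eq_sum_tournament a R hR hirr] at hcost
  simp only [Fin.snoc_last, Fin.snoc_castSucc] at hcost
  have hlower : (∑ i, a i * ∑ k, if R k i then a k else 0) + (∑ i, a i * a i) +
      (∑ i, if s i.castSucc + a i ≤ s (Fin.last n) then 0 else a i) ≤
        ∑ i, a i * (s i.castSucc + a i) := by
    rw [← Finset.sum_add_distrib, ← Finset.sum_add_distrib]
    refine Finset.sum_le_sum fun i _ => ?_
    refine le_trans (le_of_eq ?_)
      (Nat.mul_le_mul_left (a i) (Nat.add_le_add_right (hstart i) (a i)))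
    split_ifs <;> ring
  have hA : ∑ i, a i = (∑ i, if s i.castSucc + a i ≤ s (Fin.last n) then a i else 0) +
      ∑ i, if s i.castSucc + a i ≤ s (Fin.last n) then 0 else a i := by
    rw [← Finset.sum_add_distrib]
    refine Finset.sum_congr rfl fun i _ => ?_
    split_ifs <;> simp
  refine ⟨Finset.univ.filter fun i => s i.castSucc + a i ≤ s (Fin.last n), ?_⟩
  rw [Finset.sum_filter]
  simp only [Nat.not_succ_le_self, if_false, add_zero] at hbarrier
  omega

/-- Correctness of Rinnooy Kan's reduction from Subset Sum to `1|rⱼ|∑wⱼCⱼ`: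
the `n` original jobs have `p_j = w_j = a j` and release date `0`, the extra
job has processing time `1`, weight `2` and release date `T`, and the threshold
is `y = ∑_{(i,j) : i ≤ j} a i · a j + A + T + 2`. Some subset of the items sums
to `T` iff there is a single-machine schedule of the `n + 1` jobs respecting
the release dates with total weighted completion time at most `y`. -/
theorem subsetSum_to_releaseDatesWeightedCompletion (n : ℕ) (a : Fin n → ℕ)
    (ha : ∀ i, 1 ≤ a i) (T : ℕ) (hT : T ≤ ∑ i, a i) :
    (∃ S : Finset (Fin n), ∑ i ∈ S, a i = T) ↔
      (∃ s : Fin (n + 1) → ℕ, IsSchedule (Fin.snoc a 1) s ∧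
        (∀ j, (Fin.snoc (fun _ => 0) T : Fin (n + 1) → ℕ) j ≤ s j) ∧
        ∑ j, (Fin.snoc a 2 : Fin (n + 1) → ℕ) j *
            (s j + (Fin.snoc a 1 : Fin (n + 1) → ℕ) j) ≤
          (∑ q ∈ Finset.univ.filter (fun q : Fin n × Fin n => q.1 ≤ q.2),
              a q.1 * a q.2) +
            (∑ i, a i) + T + 2) := by
  constructor
  · rintro ⟨S, hS⟩
    obtain ⟨s, hs, hr, hcost⟩ := exists_schedule_of_sum_eq a S hS
    exact ⟨s, hs, hr, hcost.le⟩
  · rintro ⟨s, hs, hr, hcost⟩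
    have hlast := hr (Fin.last n)
    rw [Fin.snoc_last] at hlast
    exact exists_sum_eq_of_schedule a ha hs hlast hcost
end

section
/- Let n ∈ ℕ, a : Fin n → ℕ with a i ≥ 1 for all i, and T ∈ ℕ with T ≤ A, where A := ∑_i a i. Consider n + 1 jobs: for j ∈ Fin n, job j has processing time a j, release date 0 and due date A + 1; the extra job N has processing time 1, release date T and due date T + 1. Then there exists S ⊆ Fin n with ∑_{i ∈ S} a i = T if and only if there exists a single-machine schedule s for these n + 1 jobs with s j ≥ r j and s j + p j ≤ d j for every job j. -/
/-- Disjoint intervals contained in `[l, u)` have total length at most `u - l`. -/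
lemma sum_length_le_of_disjoint {ι : Type*} (F : Finset ι) (p s : ι → ℕ) (l u : ℕ)
    (hdisj : ∀ i ∈ F, ∀ j ∈ F, i ≠ j → s i + p i ≤ s j ∨ s j + p j ≤ s i)
    (hl : ∀ i ∈ F, l ≤ s i) (hu : ∀ i ∈ F, s i + p i ≤ u) :
    ∑ i ∈ F, p i ≤ u - l := by
  have hcard : (F.biUnion fun i => Finset.Ico (s i) (s i + p i)).card = ∑ i ∈ F, p i := by
    rw [Finset.card_biUnion]
    · simp
    · intro i hi j hj hij
      rw [Function.onFun, Finset.disjoint_left]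
      intro x hx hy
      have := hdisj i hi j hj hij
      simp only [Finset.mem_Ico] at hx hy
      omega
  rw [← hcard, ← Nat.card_Ico]
  refine Finset.card_le_card (Finset.biUnion_subset.2 fun i hi => ?_)
  exact Finset.Ico_subset_Ico (hl i hi) (hu i hi)

/-- Processing the jobs of `F` consecutively in increasing order from time `0`: a job completes
by the total processing time of any `G ⊆ F` containing it and all its predecessors. -/
lemma sum_filter_lt_add_le {ι : Type*} [LinearOrder ι] (F G : Finset ι) (p : ι → ℕ) (i : ι)
    (hi : i ∈ G) (hG : ∀ j ∈ F, j < i → j ∈ G) :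
    ∑ j ∈ F with j < i, p j + p i ≤ ∑ j ∈ G, p j := by
  rw [add_comm, ← Finset.sum_insert (by simp)]
  refine Finset.sum_le_sum_of_subset (Finset.insert_subset hi fun j hj => ?_)
  rw [Finset.mem_filter] at hj
  exact hG j hj.1 hj.2

/-- Jobs of `F` processed consecutively in increasing order do not overlap. -/
lemma sum_filter_lt_disjoint {ι : Type*} [LinearOrder ι] (F : Finset ι) (p : ι → ℕ) (i j : ι)
    (hi : i ∈ F) (hj : j ∈ F) (hij : i ≠ j) :
    ∑ k ∈ F with k < i, p k + p i ≤ ∑ k ∈ F with k < j, p k ∨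
      ∑ k ∈ F with k < j, p k + p j ≤ ∑ k ∈ F with k < i, p k := by
  rcases lt_or_gt_of_ne hij with h | h
  · exact .inl (sum_filter_lt_add_le F _ p i (by simp [hi, h])
      fun k hk hki => by simp [hk, hki.trans h])
  · exact .inr (sum_filter_lt_add_le F _ p j (by simp [hj, h])
      fun k hk hkj => by simp [hk, hkj.trans h])

/-- Correctness of the Lenstra–Rinnooy Kan–Brucker reduction from Subset Sum to
`1|rⱼ|T_max` with threshold `0`: the `n` original jobs have processing time
`a j`, release date `0` and due date `A + 1`, the extra job has processing
time `1`, release date `T` and due date `T + 1`. Some subset of the items sums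
to `T` iff there is a single-machine schedule of the `n + 1` jobs in which every
job starts no earlier than its release date and completes by its due date. -/
theorem subsetSum_to_releaseDatesTmax (n : ℕ) (a : Fin n → ℕ)
    (ha : ∀ i, 1 ≤ a i) (T : ℕ) (hT : T ≤ ∑ i, a i) :
    (∃ S : Finset (Fin n), ∑ i ∈ S, a i = T) ↔
      (∃ s : Fin (n + 1) → ℕ, IsSchedule (Fin.snoc a 1) s ∧
        (∀ j, (Fin.snoc (fun _ => 0) T : Fin (n + 1) → ℕ) j ≤ s j) ∧
        (∀ j, s j + (Fin.snoc a 1 : Fin (n + 1) → ℕ) j ≤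
          (Fin.snoc (fun _ => (∑ i, a i) + 1) (T + 1) : Fin (n + 1) → ℕ) j)) := by
  simp only [IsSchedule, Fin.forall_fin_succ', Fin.snoc_castSucc, Fin.snoc_last]
  constructor
  · rintro ⟨S, hS⟩
    have hsum := Finset.sum_add_sum_compl S a
    have hin : ∀ i ∈ S, ∑ k ∈ S with k < i, a k + a i ≤ T := fun i hi =>
      hS ▸ sum_filter_lt_add_le S S a i hi fun _ hj _ => hj
    have hout : ∀ i ∉ S, ∑ k ∈ Sᶜ with k < i, a k + a i ≤ ∑ k ∈ Sᶜ, a k := fun i hi =>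
      sum_filter_lt_add_le Sᶜ Sᶜ a i (by simpa using hi) fun _ hj _ => hj
    refine ⟨Fin.snoc (fun i => if i ∈ S then ∑ k ∈ S with k < i, a k
      else T + 1 + ∑ k ∈ Sᶜ with k < i, a k) T, ?_⟩
    simp only [Fin.snoc_castSucc, Fin.snoc_last]
    refine ⟨⟨fun i => ⟨fun j hij => ?_, fun _ => ?_⟩, fun i _ => ?_, fun h => absurd rfl h⟩,
      ⟨fun _ => Nat.zero_le _, le_rfl⟩, fun i => ?_, le_rfl⟩
    · have hij' : i ≠ j := fun h => hij (h ▸ rfl)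
      by_cases hi : i ∈ S <;> by_cases hj : j ∈ S <;> simp only [hi, hj, if_true, if_false]
      · exact sum_filter_lt_disjoint S a i j hi hj hij'
      · have := hin i hi
        omega
      · have := hin j hj
        omega
      · have := sum_filter_lt_disjoint Sᶜ a i j (by simpa using hi) (by simpa using hj) hij'
        omega
    all_goals
      by_cases hi : i ∈ S <;> simp only [hi, if_true, if_false]
      · have := hin i hi
        omega
      · have := hout i hi
        omega
  · rintro ⟨s, ⟨hd, -⟩, ⟨-, hr⟩, hdue, hlast⟩
    have hsT : s (Fin.last n) = T := by omega
    have hdisj : ∀ i j : Fin n, i ≠ j → s i.castSucc + a i ≤ s j.castSucc ∨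
        s j.castSucc + a j ≤ s i.castSucc := fun i j hij =>
      (hd i).1 j fun h => hij (Fin.castSucc_injective n h)
    let S : Finset (Fin n) := {i | s i.castSucc + a i ≤ T}
    have hbefore : ∑ i ∈ S, a i ≤ T - 0 :=
      sum_length_le_of_disjoint S a (fun i => s i.castSucc) 0 T
        (fun i _ j _ => hdisj i j) (fun _ _ => Nat.zero_le _) (fun i hi => by simpa [S] using hi)
    have hafter : ∑ i ∈ Sᶜ, a i ≤ (∑ i, a i) + 1 - (T + 1) :=
      sum_length_le_of_disjoint Sᶜ a (fun i => s i.castSucc) (T + 1) _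
        (fun i _ j _ => hdisj i j)
        (fun i hi => by
          have hlate : T < s i.castSucc + a i := by simpa [S] using hi
          have := (hd i).2 (Fin.castSucc_ne_last i)
          omega)
        (fun i _ => hdue i)
    have hsum := Finset.sum_add_sum_compl S a
    exact ⟨S, by omega⟩
end
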